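/- Let b ∈ ℝ, c ≥ 0, let ν be a Lévy measure and let α ∈ ℝ be such that (−∞, α) ⊆ D = {u : ∫_{x>1} e^{u(eˣ−1)} dν(x) < ∞}. If sup_{u<α} ψ̂′(u) < ∞, then ∫_{x>1} (eˣ−1) e^{α(eˣ−1)} dν(x) < ∞, so that ψ̂′(α) = b + (1/2 + α)c + ∫ ((eˣ−1)e^{α(eˣ−1)} − h(x)) dν(x) is well defined and finite, and moreover ψ̂′(α) = lim_{u→α⁻} ψ̂′(u). -/

import Mathlib

open MeasureTheory Filter Set
open scoped ENNReal

/-- The truncation function `h(x) = x · 1_{|x| ≤ 1}`. -/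
noncomputable def htrunc (x : ℝ) : ℝ := if |x| ≤ 1 then x else 0

/-- The set `D = {u ∈ ℝ : ∫_{x>1} e^{u(eˣ-1)} dν(x) < ∞}`. -/
def Dset (ν : Measure ℝ) : Set ℝ :=
  {u : ℝ |
    ∫⁻ x in Set.Ioi (1 : ℝ), ENNReal.ofReal (Real.exp (u * (Real.exp x - 1))) ∂ν < ⊤}

/-- `ψ̂'(u) = b + (1/2 + u)c + ∫ ((eˣ-1)e^{u(eˣ-1)} - h(x)) dν(x)`. -/
noncomputable def psihat' (b c : ℝ) (ν : Measure ℝ) (u : ℝ) : ℝ :=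
  b + (1 / 2 + u) * c +
    ∫ x, ((Real.exp x - 1) * Real.exp (u * (Real.exp x - 1)) - htrunc x) ∂ν

open Real in
/-- A bound on `exp t - 1` that is linear near the origin. -/
lemma abs_exp_sub_one_le_mul_exp_abs (t : ℝ) : |exp t - 1| ≤ |t| * exp |t| := by
  rcases le_total 0 t with ht | ht
  · rw [abs_of_nonneg ht, abs_of_nonneg (by linarith [add_one_le_exp t])]
    have h := mul_le_mul_of_nonneg_right (add_one_le_exp (-t)) (exp_pos t).le
    rw [← exp_add] at h
    simp only [neg_add_cancel, exp_zero] at h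
    linarith
  · rw [abs_of_nonpos ht, abs_of_nonpos (by linarith [exp_le_one_iff.mpr ht])]
    have h := mul_le_mul_of_nonneg_left (one_le_exp (neg_nonneg.mpr ht)) (neg_nonneg.mpr ht)
    linarith [add_one_le_exp t]

lemma measurable_htrunc : Measurable htrunc := by
  unfold htrunc
  exact Measurable.ite (measurableSet_le (by fun_prop) (by fun_prop)) measurable_id measurable_const

/-- The integrand in the definition of `ψ̂'`: nondecreasing in `u`, nonnegative for `x > 1`. -/
noncomputable def psihatIntegrand (u x : ℝ) : ℝ :=
  (Real.exp x - 1) * Real.exp (u * (Real.exp x - 1)) - htrunc x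

lemma measurable_psihatIntegrand (u : ℝ) : Measurable (psihatIntegrand u) := by
  have := measurable_htrunc
  unfold psihatIntegrand
  fun_prop

lemma psihatIntegrand_mono (x : ℝ) : Monotone fun u => psihatIntegrand u x := by
  intro u v huv
  simp only [psihatIntegrand]
  gcongr ?_ - _
  rcases le_total 0 (Real.exp x - 1) with hy | hy
  · gcongr
  · exact mul_le_mul_of_nonpos_left
      (Real.exp_le_exp.mpr (mul_le_mul_of_nonpos_right huv hy)) hy

lemma psihatIntegrand_of_one_lt (u : ℝ) {x : ℝ} (hx : 1 < x) :
    psihatIntegrand u x = (Real.exp x - 1) * Real.exp (u * (Real.exp x - 1)) := by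
  simp [psihatIntegrand, htrunc, not_le.mpr (hx.trans_le (le_abs_self x))]

lemma psihatIntegrand_nonneg (u : ℝ) {x : ℝ} (hx : 1 < x) : 0 ≤ psihatIntegrand u x := by
  rw [psihatIntegrand_of_one_lt u hx]
  have : 1 ≤ Real.exp x := Real.one_le_exp (by linarith)
  exact mul_nonneg (by linarith) (Real.exp_pos _).le

lemma continuous_psihatIntegrand (x : ℝ) : Continuous fun u => psihatIntegrand u x := by
  unfold psihatIntegrand
  fun_prop

open Real in
lemma abs_psihatIntegrand_le (u : ℝ) {x : ℝ} (hx : x ≤ 1) :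
    |psihatIntegrand u x| ≤ (1 + 4 * |u| * exp (2 * |u|)) * exp |u| * min (x ^ 2) 1 := by
  have hu := abs_nonneg u
  have he : 1 ≤ exp |u| := one_le_exp hu
  have hC : 1 ≤ 1 + 4 * |u| * exp (2 * |u|) := by
    have : 0 ≤ 4 * |u| * exp (2 * |u|) := by positivity
    linarith
  by_cases hx1 : |x| ≤ 1
  · have hxx : x ^ 2 ≤ 1 := (sq_le_one_iff_abs_le_one x).mpr hx1
    rw [min_eq_left hxx]
    have h1 := abs_exp_sub_one_sub_id_le hx1
    have h2 := abs_exp_sub_one_le hx1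
    have h3 : |exp (u * (exp x - 1)) - 1| ≤ (|u| * (2 * |x|)) * exp (2 * |u|) := by
      refine (abs_exp_sub_one_le_mul_exp_abs _).trans ?_
      have h4 : |u| * |exp x - 1| ≤ |u| * (2 * |x|) := by gcongr
      have h5 : |u| * (2 * |x|) ≤ 2 * |u| := by
        linarith [mul_le_of_le_one_right hu hx1]
      rw [abs_mul]
      exact mul_le_mul h4 (exp_le_exp.mpr (h4.trans h5)) (exp_pos _).le (by positivity)
    have heq : psihatIntegrand u x
        = (exp x - 1 - x) + (exp x - 1) * (exp (u * (exp x - 1)) - 1) := by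
      simp only [psihatIntegrand, htrunc, if_pos hx1]
      ring
    have h4 : |psihatIntegrand u x| ≤ (1 + 4 * |u| * exp (2 * |u|)) * x ^ 2 := by
      rw [heq]
      refine (abs_add_le _ _).trans ?_
      rw [abs_mul]
      have h5 := mul_le_mul h2 h3 (abs_nonneg _) (by positivity)
      have h6 : 2 * |x| * (|u| * (2 * |x|) * exp (2 * |u|))
          = 4 * |u| * exp (2 * |u|) * x ^ 2 := by
        rw [← sq_abs x]
        ring
      linarith
    refine h4.trans ?_
    gcongr
    exact le_mul_of_one_le_right (by linarith) he
  · have hx2 : x < -1 := by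
      by_contra! h
      exact hx1 (abs_le.mpr ⟨h, hx⟩)
    have hxx : 1 ≤ x ^ 2 := by nlinarith
    have hy : |exp x - 1| ≤ 1 := by
      have := exp_pos x
      have : exp x ≤ 1 := exp_le_one_iff.mpr (by linarith)
      rw [abs_le]
      constructor <;> linarith
    have hexp : exp (u * (exp x - 1)) ≤ exp |u| := by
      refine exp_le_exp.mpr ((le_abs_self _).trans ?_)
      rw [abs_mul]
      exact mul_le_of_le_one_right hu hy
    rw [min_eq_right hxx, mul_one]
    simp only [psihatIntegrand, htrunc, if_neg hx1, sub_zero]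
    rw [abs_mul, abs_exp]
    exact mul_le_mul (hy.trans hC) hexp (exp_pos _).le (by linarith)

lemma integrableOn_psihatIntegrand_Iic {ν : Measure ℝ}
    (hν : ∫⁻ x, ENNReal.ofReal (min (x ^ 2) 1) ∂ν < ⊤) (u : ℝ) :
    IntegrableOn (psihatIntegrand u) (Iic 1) ν := by
  have hint : Integrable (fun x : ℝ => min (x ^ 2) 1) ν := by
    refine ⟨by fun_prop, ?_⟩
    rwa [hasFiniteIntegral_iff_ofReal (ae_of_all _ fun x => by positivity)]
  refine Integrable.mono' (hint.integrableOn.const_mul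
    ((1 + 4 * |u| * Real.exp (2 * |u|)) * Real.exp |u|))
    (measurable_psihatIntegrand u).aestronglyMeasurable ?_
  filter_upwards [ae_restrict_mem measurableSet_Iic] with x hx
  exact abs_psihatIntegrand_le u hx

lemma integrableOn_psihatIntegrand_Ioi_iff {ν : Measure ℝ} (u : ℝ) :
    IntegrableOn (psihatIntegrand u) (Ioi 1) ν ↔
      ∫⁻ x in Ioi (1 : ℝ), ENNReal.ofReal (psihatIntegrand u x) ∂ν < ⊤ := by
  rw [← hasFiniteIntegral_iff_ofReal]
  · exact ⟨fun h => h.2, fun h => ⟨(measurable_psihatIntegrand u).aestronglyMeasurable, h⟩⟩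
  · filter_upwards [ae_restrict_mem measurableSet_Ioi] with x hx
    exact psihatIntegrand_nonneg u hx

open Real in
/-- The factor `eˣ - 1` is absorbed by a slightly larger exponent. -/
lemma integrableOn_psihatIntegrand_Ioi {ν : Measure ℝ} {u v : ℝ} (huv : u < v)
    (hv : v ∈ Dset ν) : IntegrableOn (psihatIntegrand u) (Ioi 1) ν := by
  have hint : IntegrableOn (fun x => exp (v * (exp x - 1))) (Ioi 1) ν := by
    refine ⟨by fun_prop, ?_⟩
    rw [hasFiniteIntegral_iff_ofReal (ae_of_all _ fun x => (exp_pos _).le)]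
    exact hv
  refine Integrable.mono' (hint.const_mul (v - u)⁻¹)
    (measurable_psihatIntegrand u).aestronglyMeasurable ?_
  filter_upwards [ae_restrict_mem measurableSet_Ioi] with x hx
  rw [norm_of_nonneg (psihatIntegrand_nonneg u hx), psihatIntegrand_of_one_lt u hx]
  have hd : 0 < v - u := sub_pos.mpr huv
  have h1 : (v - u) * (exp x - 1) ≤ exp ((v - u) * (exp x - 1)) := by
    linarith [add_one_le_exp ((v - u) * (exp x - 1))]
  have h2 : exp (v * (exp x - 1))
      = exp ((v - u) * (exp x - 1)) * exp (u * (exp x - 1)) := by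
    rw [← exp_add]
    ring_nf
  rw [h2, ← mul_assoc]
  gcongr
  rwa [le_inv_mul_iff₀ hd]

lemma integrable_psihatIntegrand {ν : Measure ℝ} {u : ℝ}
    (hν : ∫⁻ x, ENNReal.ofReal (min (x ^ 2) 1) ∂ν < ⊤)
    (h : IntegrableOn (psihatIntegrand u) (Ioi 1) ν) : Integrable (psihatIntegrand u) ν := by
  rw [← integrableOn_univ, ← Iic_union_Ioi (a := (1 : ℝ))]
  exact (integrableOn_psihatIntegrand_Iic hν u).union h

/-- Monotone convergence as the parameter increases to `α`. -/
lemma lintegral_psihatIntegrand_le {ν : Measure ℝ} {α : ℝ} {C : ℝ≥0∞}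
    (h : ∀ u ∈ Ico (α - 1) α,
      ∫⁻ x in Ioi (1 : ℝ), ENNReal.ofReal (psihatIntegrand u x) ∂ν ≤ C) :
    ∫⁻ x in Ioi (1 : ℝ), ENNReal.ofReal (psihatIntegrand α x) ∂ν ≤ C := by
  have hlim : Tendsto (fun n : ℕ => α - 1 / ((n : ℝ) + 1)) atTop (nhds α) := by
    simpa using tendsto_const_nhds.sub (tendsto_one_div_add_atTop_nhds_zero_nat (𝕜 := ℝ))
  refine le_of_tendsto' (lintegral_tendsto_of_tendsto_of_monotone
    (f := fun (n : ℕ) x => ENNReal.ofReal (psihatIntegrand (α - 1 / ((n : ℝ) + 1)) x))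
    (fun n => (measurable_psihatIntegrand _).ennreal_ofReal.aemeasurable)
    (ae_of_all _ fun x m n hmn => ?_) (ae_of_all _ fun x => ?_)) fun n => h _ ⟨?_, ?_⟩
  · exact ENNReal.ofReal_le_ofReal (psihatIntegrand_mono x
      (sub_le_sub_left (Nat.one_div_le_one_div hmn) α))
  · exact ENNReal.tendsto_ofReal (((continuous_psihatIntegrand x).tendsto α).comp hlim)
  · have : 1 / ((n : ℝ) + 1) ≤ 1 := by
      rw [div_le_one (by positivity)]
      linarith [n.cast_nonneg (α := ℝ)]
    linarith
  · exact sub_lt_self α (by positivity)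

/-- Fatou/monotone convergence step of Lemma 7: if `(-∞,α) ⊆ D` and
`sup_{u<α} ψ̂'(u) < ∞`, then `∫_{x>1}(eˣ-1)e^{α(eˣ-1)} dν < ∞`, `ψ̂'(α)` is well
defined and finite, and `ψ̂'(α) = lim_{u→α⁻} ψ̂'(u)`. -/
theorem stmt_9 (b c : ℝ) (hc : 0 ≤ c) (ν : Measure ℝ)
    (hν0 : ν {0} = 0)
    (hν : ∫⁻ x, ENNReal.ofReal (min (x ^ 2) 1) ∂ν < ⊤)
    (α : ℝ) (hαD : Set.Iio α ⊆ Dset ν)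
    (hbdd : ∃ M : ℝ, ∀ u < α, psihat' b c ν u ≤ M) :
    (∫⁻ x in Set.Ioi (1 : ℝ),
        ENNReal.ofReal ((Real.exp x - 1) * Real.exp (α * (Real.exp x - 1))) ∂ν < ⊤) ∧
    Integrable
      (fun x => (Real.exp x - 1) * Real.exp (α * (Real.exp x - 1)) - htrunc x) ν ∧
    Tendsto (psihat' b c ν) (nhdsWithin α (Set.Iio α)) (nhds (psihat' b c ν α)) := by
  obtain ⟨M, hM⟩ := hbdd
  have hIoi : ∀ u < α, IntegrableOn (psihatIntegrand u) (Ioi 1) ν := fun u hu => by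
    obtain ⟨v, huv, hv⟩ := exists_between hu
    exact integrableOn_psihatIntegrand_Ioi huv (hαD hv)
  have hlow := integrableOn_psihatIntegrand_Iic hν
  have hfin : ∫⁻ x in Ioi (1 : ℝ), ENNReal.ofReal (psihatIntegrand α x) ∂ν < ⊤ := by
    refine (lintegral_psihatIntegrand_le (C := ENNReal.ofReal (M - b - (1 / 2 + (α - 1)) * c
      - ∫ x in Iic (1 : ℝ), psihatIntegrand (α - 1) x ∂ν)) fun u hu => ?_).trans_lt
      ENNReal.ofReal_lt_top
    have hnonneg : 0 ≤ᵐ[ν.restrict (Ioi 1)] psihatIntegrand u := by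
      filter_upwards [ae_restrict_mem measurableSet_Ioi] with x hx
      exact psihatIntegrand_nonneg u hx
    rw [← ofReal_integral_eq_lintegral_ofReal (hIoi u hu.2) hnonneg]
    refine ENNReal.ofReal_le_ofReal ?_
    have hψ : b + (1 / 2 + u) * c + ∫ x, psihatIntegrand u x ∂ν ≤ M := hM u hu.2
    have hsplit := integral_add_compl (measurableSet_Iic (a := (1 : ℝ)))
      (integrable_psihatIntegrand hν (hIoi u hu.2))
    rw [compl_Iic] at hsplit
    have hmono : ∫ x in Iic (1 : ℝ), psihatIntegrand (α - 1) x ∂ν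
        ≤ ∫ x in Iic (1 : ℝ), psihatIntegrand u x ∂ν :=
      integral_mono (hlow _) (hlow _) fun x => psihatIntegrand_mono x hu.1
    have hcu : (1 / 2 + (α - 1)) * c ≤ (1 / 2 + u) * c := by
      gcongr
      exact hu.1
    linarith
  have hα := integrable_psihatIntegrand hν ((integrableOn_psihatIntegrand_Ioi_iff α).mpr hfin)
  have hα' := integrable_psihatIntegrand hν (hIoi (α - 1) (sub_one_lt α))
  refine ⟨?_, hα, ?_⟩
  · refine (setLIntegral_congr_fun measurableSet_Ioi fun x hx => ?_).trans_lt hfin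
    simp only [psihatIntegrand_of_one_lt α hx]
  · refine Tendsto.add (Continuous.tendsto' (by fun_prop) _ _ rfl |>.mono_left nhdsWithin_le_nhds)
      ?_
    refine tendsto_integral_filter_of_dominated_convergence
      (F := psihatIntegrand) (f := psihatIntegrand α)
      (fun x => |psihatIntegrand (α - 1) x| + |psihatIntegrand α x|)
      (Eventually.of_forall fun u => (measurable_psihatIntegrand u).aestronglyMeasurable)
      ?_ (hα'.abs.add hα.abs) (ae_of_all _ fun x =>
        ((continuous_psihatIntegrand x).tendsto α).mono_left nhdsWithin_le_nhds)
    filter_upwards [Ioo_mem_nhdsLT (sub_one_lt α)] with u hu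
    refine ae_of_all _ fun x => ?_
    have h1 : psihatIntegrand (α - 1) x ≤ psihatIntegrand u x := psihatIntegrand_mono x hu.1.le
    have h2 : psihatIntegrand u x ≤ psihatIntegrand α x := psihatIntegrand_mono x hu.2.le
    rw [Real.norm_eq_abs, abs_le]
    constructor
    · linarith [neg_abs_le (psihatIntegrand (α - 1) x), abs_nonneg (psihatIntegrand α x)]
    · linarith [le_abs_self (psihatIntegrand α x), abs_nonneg (psihatIntegrand (α - 1) x)]
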